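/- Let 𝕏 ⊂ ℝ be a finite set such that the difference of any two distinct elements of 𝕏 is not an integer, let μ : 𝕏 → ℝ be any function, and let u_0 be a real number. Then for every n ≥ 1, Σ_{G ∈ MC_n} Σ_{x ∈ D_G} α_G(x) f_G(x) = Σ_{G ∈ MC_n} Σ_{x ∈ D_G^{≠}} α_G(x) f_G(x), where MC_n is the set of multi-caterpillar graphs with marked vertices {1, ..., n}, D_G is the set of decorations of G with values in 𝕏, and D_G^{≠} ⊆ D_G is the subset of black-injective decorations. -/

import Mathlib

open Finset

open scoped Classical

/-- Data encoding a multi-caterpillar graph with marked vertices `Fin n`: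
the first component sends each vertex to the centre of its star, the second
component gives the weight of the incoming star edge of each red vertex
(and `0` for the centres), and the third component is the partial successor
map of the multi-spine graph on the centres. -/
def MCData (n : ℕ) : Type :=
  (Fin n → Fin n) × (Fin n → Fin n) × (Fin n → Option (Fin n))

noncomputable instance (n : ℕ) : Fintype (MCData n) := by
  unfold MCData; infer_instance

/-- The star of the vertex `v`: all vertices sharing the centre of `v`. -/
noncomputable def star' {n : ℕ} (G : MCData n) (v : Fin n) : Finset (Fin n) :=
  univ.filter (fun u => G.1 u = G.1 v)

/-- `G` encodes a multi-caterpillar graph with marked vertices `{1, ..., n}`: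
the centre map is idempotent; within each star of size `a` the weights form a
bijection onto `{0, 1, ..., a-1}`, with weight `0` exactly at the centre (so the
red vertices of the star carry the weights `1, ..., a-1`); the spine successor
map is defined only on centres, takes values in centres, is injective, and
produces no directed cycles (so the spine components are directed paths). -/
def IsMultiCaterpillar (n : ℕ) (G : MCData n) : Prop :=
  (∀ v, G.1 (G.1 v) = G.1 v) ∧
  (∀ v, (G.2.1 v : ℕ) < (star' G v).card) ∧
  (∀ u v, G.1 u = G.1 v → G.2.1 u = G.2.1 v → u = v) ∧
  (∀ v, (G.2.1 v : ℕ) = 0 ↔ G.1 v = v) ∧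
  (∀ v, G.2.2 v ≠ none → G.1 v = v) ∧
  (∀ v c, G.2.2 v = some c → G.1 c = c) ∧
  (∀ u v c, G.2.2 u = some c → G.2.2 v = some c → u = v) ∧
  (∀ v, ¬ Relation.TransGen (fun i j => G.2.2 i = some j) v v)

/-- The black vertices (the centres of the stars). -/
noncomputable def blacks {n : ℕ} (G : MCData n) : Finset (Fin n) :=
  univ.filter (fun v => G.1 v = v)

/-- The heads of the connected components of the multi-caterpillar graph:
centres with no incoming spine edge. -/
noncomputable def mcHeads {n : ℕ} (G : MCData n) : Finset (Fin n) :=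
  univ.filter (fun v => G.1 v = v ∧ ∀ u, G.2.2 u ≠ some v)

/-- The vertex set of the connected component of the head `h`: all vertices whose
centre is reachable from `h` along spine edges. -/
noncomputable def mcComponent {n : ℕ} (G : MCData n) (h : Fin n) : Finset (Fin n) :=
  univ.filter (fun v => Relation.ReflTransGen (fun i j => G.2.2 i = some j) h (G.1 v))

/-- The product `f_G(x)` of the reciprocals `1/(x_j - x_i + w)` over all weighted
edges `(i, j, w)` of the multi-caterpillar graph: the star edges from each centre
to its red vertices (with weights `1, ..., a-1`) and the spine edges (each spine
edge leaving a centre `c` having weight equal to the size `a_c` of its star). -/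
noncomputable def fMC {n : ℕ} (G : MCData n) (x : Fin n → ℝ) : ℝ :=
  (∏ v ∈ univ.filter (fun v => G.1 v ≠ v),
      1 / (x v - x (G.1 v) + ((G.2.1 v : ℕ) : ℝ))) *
    ∏ v ∈ univ.filter (fun v : Fin n => (G.2.2 v).isSome),
      1 / (x ((G.2.2 v).getD v) - x v + ((star' G v).card : ℝ))

/-- The coefficient `α_G(x)`. -/
noncomputable def alphaMC {n : ℕ} (μ : ℝ → ℝ) (G : MCData n) (x : Fin n → ℝ) : ℝ :=
  (-1 : ℝ) ^ (blacks G).card * (∏ v, μ (x v)) *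
    ∏ h ∈ mcHeads G, (-1 / ((mcComponent G h).card : ℝ))

/-- The edge relation of the partial successor map `s`. -/
def SuccRel {B : Type*} (s : B → Option B) (i j : B) : Prop := s i = some j

/-- The partial successor map `s` describes a disjoint union of directed paths. -/
def IsSpine {B : Type*} (s : B → Option B) : Prop :=
  (∀ u v c, s u = some c → s v = some c → u = v) ∧ ∀ v, ¬ Relation.TransGen (SuccRel s) v v

/-- The elements without incoming edge. -/
noncomputable def spineHeads {B : Type*} [Fintype B] (s : B → Option B) : Finset B :=
  univ.filter fun h => ∀ u, s u ≠ some h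

theorem card_quotient_sameCycle_sign {B : Type*} [Fintype B] (σ : Equiv.Perm B) :
    (-1 : ℝ) ^ Fintype.card (Quotient (Equiv.Perm.SameCycle.setoid σ)) =
      (-1) ^ Fintype.card B * ((Equiv.Perm.sign σ : ℤ) : ℝ) := by
  have hout (v : B) : σ.SameCycle (Quotient.out (s := Equiv.Perm.SameCycle.setoid σ) ⟦v⟧) v :=
    Quotient.mk_out (s := Equiv.Perm.SameCycle.setoid σ) v
  have h1 : #{q : Quotient (Equiv.Perm.SameCycle.setoid σ) | σ q.out ≠ q.out} =
      #σ.cycleFactorsFinset := by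
    refine Finset.card_bij (fun q _ => σ.cycleOf q.out) ?_ ?_ ?_
    · intro q hq
      rw [Equiv.Perm.cycleOf_mem_cycleFactorsFinset_iff, Equiv.Perm.mem_support]
      exact (mem_filter.1 hq).2
    · intro q hq q' hq' h
      have := (Equiv.Perm.sameCycle_iff_cycleOf_eq_of_mem_support
        (Equiv.Perm.mem_support.2 (mem_filter.1 hq).2)
        (Equiv.Perm.mem_support.2 (mem_filter.1 hq').2)).2 h
      rw [← q.out_eq, ← q'.out_eq]
      exact Quotient.sound this
    · intro c hc
      obtain ⟨v, hv⟩ := (Equiv.Perm.mem_cycleFactorsFinset_iff.1 hc).1.nonempty_support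
      have hvσ := Equiv.Perm.mem_cycleFactorsFinset_support_le hc hv
      refine ⟨⟦v⟧, ?_, ?_⟩
      · simp only [mem_filter, mem_univ, true_and]
        exact Equiv.Perm.mem_support.1 ((hout v).mem_support_iff.2 hvσ)
      · rw [(hout v).cycleOf_eq, Equiv.Perm.cycle_is_cycleOf hv hc]
  have h2 : #{q : Quotient (Equiv.Perm.SameCycle.setoid σ) | σ q.out = q.out} =
      #{v | σ v = v} := by
    refine Finset.card_bij (fun q _ => q.out) ?_ ?_ ?_
    · intro q hq; simpa using hq
    · intro q _ q' _ h; exact Quotient.out_injective h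
    · intro v hv
      have hv' : σ v = v := by simpa using hv
      have : Quotient.out (s := Equiv.Perm.SameCycle.setoid σ) ⟦v⟧ = v :=
        (Equiv.Perm.SameCycle.eq_of_right (hout v) hv')
      exact ⟨⟦v⟧, by simp [this, hv'], this⟩
  have h3 := Finset.card_filter_add_card_filter_not (s := (univ : Finset
    (Quotient (Equiv.Perm.SameCycle.setoid σ)))) (fun q => σ q.out = q.out)
  have h4 := Finset.card_filter_add_card_filter_not (s := (univ : Finset B)) (fun v => σ v = v)
  have h5 : #σ.support = #{v | ¬ σ v = v} := by congr 1
  rw [Equiv.Perm.sign_of_cycleType, Equiv.Perm.sum_cycleType,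
    Equiv.Perm.cycleType_def, Multiset.card_map]
  rw [Finset.card_univ] at h3 h4
  rw [← h3, ← h4, h2, ← h5]
  simp only [ne_eq] at h1
  rw [h1]
  push_cast
  rw [← Finset.card_def, pow_add, pow_add, pow_add]
  have : ((-1 : ℝ) ^ #σ.support) * (-1) ^ #σ.support = 1 := by
    rw [← mul_pow]; norm_num
  linear_combination (-(-1 : ℝ) ^ #{v | σ v = v} * (-1 : ℝ) ^ #σ.cycleFactorsFinset) * this

theorem succRel_rightUnique {B : Type*} (s : B → Option B) : Relator.RightUnique (SuccRel s) := by
  intro a b c h h'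
  exact Option.some.inj (h.symm.trans h')

/-- In a partial injection, a point on a directed cycle is not reachable from a head. -/
theorem not_transGen_self_of_reflTransGen {B : Type*} {s : B → Option B}
    (hs : ∀ u v c, s u = some c → s v = some c → u = v) {h v : B}
    (hh : ∀ u, s u ≠ some h) (hv : Relation.ReflTransGen (SuccRel s) h v) :
    ¬ Relation.TransGen (SuccRel s) v v := by
  induction hv with
  | refl =>
    intro ht
    obtain ⟨u, -, hu⟩ := Relation.TransGen.tail'_iff.1 ht
    exact hh u hu
  | tail _ hbc ih =>
    intro ht
    obtain ⟨u, hu, huc⟩ := Relation.TransGen.tail'_iff.1 ht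
    rw [hs _ _ _ huc hbc] at hu
    exact ih (Relation.TransGen.head' hbc hu)

theorem IsSpine.exists_head {B : Type*} [Finite B] {s : B → Option B} (hs : IsSpine s) (v : B) :
    ∃ h, (∀ u, s u ≠ some h) ∧ Relation.ReflTransGen (SuccRel s) h v := by
  have : Std.Irrefl (Relation.TransGen (SuccRel s)) := ⟨hs.2⟩
  have wf := Finite.wellFounded_of_trans_of_irrefl (Relation.TransGen (SuccRel s))
  induction v using wf.induction with
  | _ v ih =>
    by_cases hv : ∀ u, s u ≠ some v
    · exact ⟨v, hv, .refl⟩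
    · push Not at hv
      obtain ⟨u, hu⟩ := hv
      obtain ⟨h, hh, hr⟩ := ih u (.single hu)
      exact ⟨h, hh, hr.tail hu⟩

theorem IsSpine.head_unique {B : Type*} {s : B → Option B} (hs : IsSpine s) {h h' v : B}
    (hh : ∀ u, s u ≠ some h) (hh' : ∀ u, s u ≠ some h')
    (hv : Relation.ReflTransGen (SuccRel s) h v) (hv' : Relation.ReflTransGen (SuccRel s) h' v) :
    h = h' := by
  have key : ∀ {a b : B}, (∀ u, s u ≠ some b) → Relation.ReflTransGen (SuccRel s) a b → a = b := by
    intro a b hb hab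
    rcases hab.cases_tail with h | ⟨c, _, hc⟩
    · exact h.symm
    · exact absurd hc (hb c)
  induction hv with
  | refl => exact (key hh hv').symm
  | tail _ hbc ih =>
    rcases hv'.cases_tail with h | ⟨c, hc, hc'⟩
    · subst h; exact absurd hbc (hh' _)
    · rw [hs.1 _ _ _ hc' hbc] at hc
      exact ih hc

/-- Cut each cycle of `σ` just before the representative of its class. -/
noncomputable def cutPerm {B : Type*} (σ : Equiv.Perm B) (r : B → B) (v : B) : Option B :=
  if r v = σ v then none else some (σ v)

section cut

variable {B : Type*} {σ : Equiv.Perm B} {r : B → B}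

theorem cutPerm_eq_some {v w : B} : cutPerm σ r v = some w ↔ r v ≠ σ v ∧ σ v = w := by
  unfold cutPerm; split_ifs with h <;> simp [h]

theorem cutPerm_head_iff (h2 : ∀ v w, σ.SameCycle v w → r v = r w) (h : B) :
    (∀ u, cutPerm σ r u ≠ some h) ↔ r h = h := by
  constructor
  · intro hh
    have := hh (σ.symm h)
    rw [Ne, cutPerm_eq_some] at this
    simp only [Equiv.apply_symm_apply, and_true, not_not] at this
    rw [← this]
    apply h2
    rw [this]
    conv_lhs => rw [← σ.apply_symm_apply h]
    exact (Equiv.Perm.sameCycle_apply_left.2 (Equiv.Perm.SameCycle.refl _ _))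
  · intro hh u hu
    rw [cutPerm_eq_some] at hu
    apply hu.1
    rw [hu.2, ← hh]
    apply h2
    rw [← hu.2]
    exact (Equiv.Perm.sameCycle_apply_right.2 (Equiv.Perm.SameCycle.refl _ _))

theorem cutPerm_sameCycle_of_reach {v w : B}
    (h : Relation.ReflTransGen (SuccRel (cutPerm σ r)) v w) : σ.SameCycle v w := by
  induction h with
  | refl => exact .refl _ _
  | tail _ hbc ih =>
    rw [SuccRel, cutPerm_eq_some] at hbc
    rw [← hbc.2]
    exact Equiv.Perm.sameCycle_apply_right.2 ih

theorem cutPerm_reach [Fintype B] (h1 : ∀ v, σ.SameCycle v (r v))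
    (h2 : ∀ v w, σ.SameCycle v w → r v = r w) (v : B) :
    Relation.ReflTransGen (SuccRel (cutPerm σ r)) (r v) v := by
  obtain ⟨k, -, hk⟩ := Equiv.Perm.SameCycle.exists_pow_eq' (h1 v).symm
  have main : ∀ k : ℕ, ∀ w, r w = r v → (σ ^ k) (r v) = w →
      Relation.ReflTransGen (SuccRel (cutPerm σ r)) (r v) w := by
    intro k
    induction k with
    | zero => intro w _ hw; simp only [pow_zero, Equiv.Perm.coe_one, id_eq] at hw; rw [hw]
    | succ k ih =>
      intro w hrw hw
      rw [pow_succ', Equiv.Perm.mul_apply] at hw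
      by_cases hwr : w = r v
      · rw [hwr]
      · have hr : r ((σ ^ k) (r v)) = r v := by
          refine (h2 _ w ?_).trans hrw
          rw [← hw]
          exact Equiv.Perm.sameCycle_apply_right.2 (.refl _ _)
        refine (ih _ hr rfl).tail ?_
        rw [SuccRel, cutPerm_eq_some]
        refine ⟨?_, hw⟩
        rw [hr, hw]
        exact fun h => hwr h.symm
  exact main k v rfl hk

theorem cutPerm_reach_iff [Fintype B] (h1 : ∀ v, σ.SameCycle v (r v))
    (h2 : ∀ v w, σ.SameCycle v w → r v = r w) {h v : B} (hh : r h = h) :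
    Relation.ReflTransGen (SuccRel (cutPerm σ r)) h v ↔ σ.SameCycle h v := by
  refine ⟨cutPerm_sameCycle_of_reach, fun hs => ?_⟩
  have := cutPerm_reach h1 h2 v
  rwa [← h2 _ _ hs, hh] at this

theorem cutPerm_isSpine [Fintype B] (h1 : ∀ v, σ.SameCycle v (r v))
    (h2 : ∀ v w, σ.SameCycle v w → r v = r w) : IsSpine (cutPerm σ r) := by
  have hi : ∀ u v c, cutPerm σ r u = some c → cutPerm σ r v = some c → u = v := by
    intro u v c hu hv
    rw [cutPerm_eq_some] at hu hv
    exact σ.injective (hu.2.trans hv.2.symm)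
  refine ⟨hi, fun v => not_transGen_self_of_reflTransGen hi ?_ (cutPerm_reach h1 h2 v)⟩
  rw [cutPerm_head_iff h2]
  exact (h2 _ _ (h1 v)).symm

theorem cutPerm_injective [Fintype B] {σ' : Equiv.Perm B} {r' : B → B}
    (h1 : ∀ v, σ.SameCycle v (r v)) (h2 : ∀ v w, σ.SameCycle v w → r v = r w)
    (h1' : ∀ v, σ'.SameCycle v (r' v)) (h2' : ∀ v w, σ'.SameCycle v w → r' v = r' w)
    (h : cutPerm σ r = cutPerm σ' r') : σ = σ' ∧ r = r' := by
  have hr : r = r' := by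
    funext v
    refine (cutPerm_isSpine h1 h2).head_unique (v := v) ?_ ?_ (cutPerm_reach h1 h2 v) ?_
    · exact (cutPerm_head_iff h2 _).2 (h2 _ _ (h1 v)).symm
    · rw [h]; exact (cutPerm_head_iff h2' _).2 (h2' _ _ (h1' v)).symm
    · rw [h]; exact cutPerm_reach h1' h2' v
  refine ⟨Equiv.ext fun v => ?_, hr⟩
  have := congrFun h v
  rw [← hr] at this
  unfold cutPerm at this
  split_ifs at this with ha hb
  · exact ha.symm.trans hb
  · exact Option.some.inj this

end cut

theorem IsSpine.exists_cutPerm {B : Type*} [Fintype B] {s : B → Option B} (hs : IsSpine s) :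
    ∃ (σ : Equiv.Perm B) (r : B → B), (∀ v, σ.SameCycle v (r v)) ∧
      (∀ v w, σ.SameCycle v w → r v = r w) ∧ cutPerm σ r = s := by
  choose r hr1 hr2 using hs.exists_head
  have hr3 : ∀ {v w}, Relation.ReflTransGen (SuccRel s) v w → r v = r w := fun {v w} h =>
    hs.head_unique (hr1 v) (hr1 w) ((hr2 v).trans h) (hr2 w)
  set f : B → B := fun v => (s v).getD (r v) with hf
  have hsome : ∀ {v w}, s v = some w → f v = w := fun h => by simp [hf, h]
  have hnone : ∀ {v}, s v = none → f v = r v := fun h => by simp [hf, h]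
  have key : ∀ {u v}, s u = none → Relation.ReflTransGen (SuccRel s) u v → u = v := by
    intro u v hu h
    rcases h.cases_head with h | ⟨c, hc, -⟩
    · exact h
    · rw [SuccRel, hu] at hc; cases hc
  have hinj : Function.Injective f := by
    intro u v huv
    rcases hu : s u with _ | c <;> rcases hv : s v with _ | d
    · rw [hnone hu, hnone hv] at huv
      have h := hr2 u
      rw [huv] at h
      rcases Relation.ReflTransGen.total_of_right_unique (succRel_rightUnique s) h (hr2 v)
        with h | h
      · exact key hu h
      · exact (key hv h).symm
    · rw [hnone hu, hsome hv] at huv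
      exact absurd (huv ▸ hv) (hr1 u v)
    · rw [hsome hu, hnone hv] at huv
      exact absurd (huv ▸ hu) (hr1 v u)
    · rw [hsome hu, hsome hv] at huv
      exact hs.1 u v c hu (huv ▸ hv)
  have hrf : ∀ v, r (f v) = r v := by
    intro v
    rcases hv : s v with _ | c
    · rw [hnone hv]; exact hr3 (hr2 v)
    · rw [hsome hv]; exact (hr3 (.single hv)).symm
  let σ : Equiv.Perm B := Equiv.ofBijective f (Finite.injective_iff_bijective.1 hinj)
  have hσ : ∀ v, σ v = f v := fun v => rfl
  refine ⟨σ, r, fun v => ?_, fun v w h => ?_, ?_⟩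
  · have : ∀ w, Relation.ReflTransGen (SuccRel s) (r v) w → σ.SameCycle (r v) w := by
      intro w hw
      induction hw with
      | refl => exact .refl _ _
      | tail _ hbc ih =>
        rw [← hsome hbc, ← hσ]
        exact Equiv.Perm.sameCycle_apply_right.2 ih
    exact (this v (hr2 v)).symm
  · obtain ⟨k, -, rfl⟩ := Equiv.Perm.SameCycle.exists_pow_eq' h
    clear h
    induction k with
    | zero => rfl
    | succ k ih => rw [pow_succ', Equiv.Perm.mul_apply, hσ, hrf, ih]
  · funext v
    rw [cutPerm, hσ]
    rcases hv : s v with _ | c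
    · rw [hnone hv, if_pos rfl]
    · rw [hsome hv, if_neg]
      rintro h
      exact hr1 v v (h ▸ hv)

theorem mem_spineHeads {B : Type*} [Fintype B] {s : B → Option B} {h : B} :
    h ∈ spineHeads s ↔ ∀ u, s u ≠ some h := by
  simp [spineHeads]

/-- The weight of a spine graph with star sizes `a` and decorations `x`. -/
noncomputable def spineWeight {B : Type*} [Fintype B] (a x : B → ℝ) (s : B → Option B) : ℝ :=
  (∏ h ∈ spineHeads s, -1 / ∑ b with Relation.ReflTransGen (SuccRel s) h b, a b) *
    ∏ v with (s v).isSome, 1 / (x ((s v).getD v) - x v + a v)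

section weight

variable {B : Type*} [Fintype B] {a x : B → ℝ}

/-- The contribution of cutting a cycle of `σ` before `h`. -/
noncomputable def cutFactor (a x : B → ℝ) (σ : Equiv.Perm B) (h : B) : ℝ :=
  (-1 / ∑ b with σ.SameCycle h b, a b) * (x h - x (σ.symm h) + a (σ.symm h))

theorem spineWeight_cutPerm (hne : ∀ i j, x j - x i + a i ≠ 0) {σ : Equiv.Perm B} {r : B → B}
    (h1 : ∀ v, σ.SameCycle v (r v)) (h2 : ∀ v w, σ.SameCycle v w → r v = r w) :
    spineWeight a x (cutPerm σ r) =
      (∏ v, 1 / (x (σ v) - x v + a v)) * ∏ h with r h = h, cutFactor a x σ h := by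
  have hheads : spineHeads (cutPerm σ r) = univ.filter fun h => r h = h :=
    Finset.filter_congr fun h _ => cutPerm_head_iff h2 h
  have hsome : ∀ v, (cutPerm σ r v).isSome ↔ ¬ r v = σ v := by
    intro v; unfold cutPerm; split_ifs with h <;> simp [h]
  have hedges : ∏ v with (cutPerm σ r v).isSome,
      1 / (x ((cutPerm σ r v).getD v) - x v + a v) =
      ∏ v with ¬ r v = σ v, 1 / (x (σ v) - x v + a v) := by
    refine Finset.prod_congr (Finset.filter_congr fun v _ => hsome v) fun v hv => ?_
    have : ¬ r v = σ v := (mem_filter.1 hv).2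
    simp [cutPerm, this]
  have hcut : ∏ h with r h = h, (x h - x (σ.symm h) + a (σ.symm h)) =
      ∏ v with r v = σ v, (x (σ v) - x v + a v) := by
    refine Finset.prod_equiv σ.symm (fun h => ?_) (fun h _ => by simp)
    simp only [mem_filter, mem_univ, true_and, Equiv.apply_symm_apply]
    rw [h2 (σ.symm h) h]
    simpa using (Equiv.Perm.sameCycle_apply_right (f := σ) (x := σ.symm h) (y := σ.symm h)).2
      (.refl _ _)
  have hcomp : ∏ h with r h = h,
      (-1 / ∑ b with Relation.ReflTransGen (SuccRel (cutPerm σ r)) h b, a b) =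
      ∏ h with r h = h, (-1 / ∑ b with σ.SameCycle h b, a b) := by
    refine Finset.prod_congr rfl fun h hh => ?_
    congr 2
    exact Finset.filter_congr fun b _ => cutPerm_reach_iff h1 h2 (mem_filter.1 hh).2
  unfold spineWeight cutFactor
  rw [hheads, hedges, hcomp, Finset.prod_mul_distrib, hcut,
    ← Finset.prod_filter_mul_prod_filter_not univ (fun v => r v = σ v)
      (fun v => 1 / (x (σ v) - x v + a v))]
  have : (∏ v with r v = σ v, 1 / (x (σ v) - x v + a v)) *
      ∏ v with r v = σ v, (x (σ v) - x v + a v) = 1 := by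
    rw [← Finset.prod_mul_distrib]
    exact Finset.prod_eq_one fun v _ => one_div_mul_cancel (hne _ _)
  linear_combination (-(∏ v with ¬ r v = σ v, 1 / (x (σ v) - x v + a v)) *
    (∏ h with r h = h, (-1 / ∑ b with σ.SameCycle h b, a b))) * this

theorem sum_cutFactor_cycle (ha : ∀ i, 0 < a i) (σ : Equiv.Perm B) (c : B) :
    ∑ h with σ.SameCycle c h, cutFactor a x σ h = -1 := by
  have hA : ∀ h ∈ univ.filter (fun h => σ.SameCycle c h), cutFactor a x σ h =
      (-1 / ∑ b with σ.SameCycle c b, a b) * (x h - x (σ.symm h) + a (σ.symm h)) := by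
    intro h hh
    have hh' : σ.SameCycle c h := (mem_filter.1 hh).2
    unfold cutFactor
    congr 3
    exact Finset.filter_congr fun b _ => ⟨hh'.trans, hh'.symm.trans⟩
  have hs : ∀ g : B → ℝ, ∑ h with σ.SameCycle c h, g (σ.symm h) =
      ∑ h with σ.SameCycle c h, g h := by
    intro g
    refine Finset.sum_equiv σ.symm (fun h => ?_) (fun _ _ => rfl)
    simp only [mem_filter, mem_univ, true_and]
    conv_lhs => rw [← σ.apply_symm_apply h]
    exact Equiv.Perm.sameCycle_apply_right
  have hpos : 0 < ∑ b with σ.SameCycle c b, a b :=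
    Finset.sum_pos (fun b _ => ha b) ⟨c, by simpa using .refl _ _⟩
  rw [Finset.sum_congr rfl hA, ← Finset.mul_sum, Finset.sum_add_distrib, Finset.sum_sub_distrib,
    hs x, hs a]
  field_simp
  ring

/-- Closing paths into cycles turns the sum over spine graphs into a sum over permutations. -/
theorem sum_spineWeight_eq_sum_perm (ha : ∀ i, 0 < a i) (hne : ∀ i j, x j - x i + a i ≠ 0) :
    ∑ s with IsSpine s, spineWeight a x s =
      ∑ σ : Equiv.Perm B, (-1 : ℝ) ^ Fintype.card (Quotient (Equiv.Perm.SameCycle.setoid σ)) *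
        ∏ v, 1 / (x (σ v) - x v + a v) := by
  let mk (σ : Equiv.Perm B) (v : B) : Quotient (Equiv.Perm.SameCycle.setoid σ) := ⟦v⟧
  let T (σ : Equiv.Perm B) : Finset (Quotient (Equiv.Perm.SameCycle.setoid σ) → B) :=
    Fintype.piFinset fun q => univ.filter fun v => mk σ v = q
  have hmk : ∀ {σ : Equiv.Perm B} {v w : B}, mk σ v = mk σ w ↔ σ.SameCycle v w := fun {_ _ _} =>
    Quotient.eq (r := Equiv.Perm.SameCycle.setoid _)
  have hT : ∀ {σ : Equiv.Perm B} {p}, p ∈ T σ ↔ ∀ q, mk σ (p q) = q := by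
    intro σ p; simp [T]
  have h1 : ∀ {σ : Equiv.Perm B} {p}, p ∈ T σ → ∀ v, σ.SameCycle v (p (mk σ v)) :=
    fun hp v => hmk.1 (hT.1 hp _).symm
  have h2 : ∀ {σ : Equiv.Perm B} {p : Quotient (Equiv.Perm.SameCycle.setoid σ) → B} (v w),
      σ.SameCycle v w → p (mk σ v) = p (mk σ w) := fun v w h => by rw [hmk.2 h]
  have hprod : ∀ σ : Equiv.Perm B, (-1 : ℝ) ^
      Fintype.card (Quotient (Equiv.Perm.SameCycle.setoid σ)) =
      ∑ p ∈ T σ, ∏ h with p (mk σ h) = h, cutFactor a x σ h := by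
    intro σ
    have : ∀ p ∈ T σ, ∏ h with p (mk σ h) = h, cutFactor a x σ h =
        ∏ q, cutFactor a x σ (p q) := by
      intro p hp
      symm
      refine Finset.prod_bij' (fun q _ => p q) (fun h _ => mk σ h) ?_ ?_ ?_ ?_ ?_
      · intro q _; simp [hT.1 hp q]
      · intro h _; simp
      · intro q _; exact hT.1 hp q
      · intro h hh; exact (mem_filter.1 hh).2
      · intro q _; rfl
    rw [Finset.sum_congr rfl this, ← Finset.prod_univ_sum]
    rw [← Finset.card_univ, ← Finset.prod_const]
    refine Finset.prod_congr rfl fun q _ => ?_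
    induction q using Quotient.inductionOn with
    | _ c =>
      rw [← sum_cutFactor_cycle (x := x) ha σ c]
      refine Finset.sum_congr (Finset.filter_congr fun v _ => ?_) fun _ _ => rfl
      exact ⟨fun h => hmk.2 h.symm, fun h => (hmk.1 h).symm⟩
  simp_rw [hprod, Finset.sum_mul]
  rw [Finset.sum_sigma']
  symm
  refine Finset.sum_bij (fun e _ => cutPerm e.1 fun v => e.2 (mk e.1 v)) ?_ ?_ ?_ ?_
  · rintro ⟨σ, p⟩ he
    simp only [mem_sigma, mem_univ, true_and] at he
    simpa using cutPerm_isSpine (h1 he) h2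
  · rintro ⟨σ, p⟩ he ⟨σ', p'⟩ he' h
    simp only [mem_sigma, mem_univ, true_and] at he he'
    obtain ⟨rfl, hp⟩ := cutPerm_injective (h1 he) h2 (h1 he') h2 h
    congr 1
    funext q
    induction q using Quotient.inductionOn with
    | _ c => exact congrFun hp c
  · intro s hs
    obtain ⟨σ, r, hr1, hr2, hs'⟩ := (mem_filter.1 hs).2.exists_cutPerm
    refine ⟨⟨σ, Quotient.lift r hr2⟩, ?_, hs'⟩
    simp only [mem_sigma, mem_univ, true_and]
    refine hT.2 fun q => ?_
    induction q using Quotient.inductionOn with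
    | _ c => exact hmk.2 (hr1 c).symm
  · rintro ⟨σ, p⟩ he
    simp only [mem_sigma, mem_univ, true_and] at he
    rw [spineWeight_cutPerm hne (h1 he) h2, mul_comm]

theorem sum_spineWeight_eq_det (ha : ∀ i, 0 < a i) (hne : ∀ i j, x j - x i + a i ≠ 0) :
    ∑ s with IsSpine s, spineWeight a x s =
      (-1) ^ Fintype.card B * (Matrix.of fun j i => 1 / (x j - x i + a i)).det := by
  rw [sum_spineWeight_eq_sum_perm ha hne, Matrix.det_apply', Finset.mul_sum]
  refine Finset.sum_congr rfl fun σ _ => ?_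
  rw [card_quotient_sameCycle_sign, mul_assoc]
  rfl

theorem sum_spineWeight_eq_zero (ha : ∀ i, 0 < a i) (hne : ∀ i j, x j - x i + a i ≠ 0)
    {u v : B} (huv : u ≠ v) (hx : x u = x v) : ∑ s with IsSpine s, spineWeight a x s = 0 := by
  rw [sum_spineWeight_eq_det ha hne, Matrix.det_zero_of_row_eq huv, mul_zero]
  funext i
  simp [hx]

end weight

section transfer

variable {n : ℕ} {c : Fin n → Fin n}

/-- Extend a spine map on the centres of `c` to all vertices. -/
noncomputable def extendSpine (c : Fin n → Fin n) (s : {v // c v = v} → Option {v // c v = v})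
    (v : Fin n) : Option (Fin n) :=
  if h : c v = v then (s ⟨v, h⟩).map Subtype.val else none

theorem extendSpine_coe (s : {v // c v = v} → Option {v // c v = v}) (b : {v // c v = v}) :
    extendSpine c s b = (s b).map Subtype.val := by
  simp [extendSpine, b.2]

theorem extendSpine_eq_some {s : {v // c v = v} → Option {v // c v = v}} {v u : Fin n} :
    extendSpine c s v = some u ↔ ∃ (hv : c v = v) (hu : c u = u), s ⟨v, hv⟩ = some ⟨u, hu⟩ := by
  unfold extendSpine
  split_ifs with h
  · rw [Option.map_eq_some_iff]
    constructor
    · rintro ⟨b, hb, rfl⟩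
      exact ⟨h, b.2, hb⟩
    · rintro ⟨_, hu, hs⟩
      exact ⟨_, hs, rfl⟩
  · simp [h]

theorem extendSpine_coe_eq_some {s : {v // c v = v} → Option {v // c v = v}}
    {b d : {v // c v = v}} : extendSpine c s b = some ↑d ↔ s b = some d := by
  rw [extendSpine_eq_some]
  exact ⟨fun ⟨_, _, h⟩ => h, fun h => ⟨b.2, d.2, h⟩⟩

theorem extendSpine_injective : Function.Injective (extendSpine c) := by
  intro s t h
  funext b
  have := congrFun h b
  rw [extendSpine_coe, extendSpine_coe] at this
  exact Option.map_injective Subtype.val_injective this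

theorem exists_extendSpine {S : Fin n → Option (Fin n)} (h1 : ∀ v, S v ≠ none → c v = v)
    (h2 : ∀ v u, S v = some u → c u = u) : ∃ s, extendSpine c s = S := by
  refine ⟨fun b => (S b).bind fun u => if h : c u = u then some ⟨u, h⟩ else none, ?_⟩
  funext v
  by_cases hv : c v = v
  · rcases hS : S v with _ | u
    · simp [extendSpine, hS]
    · simp [extendSpine, hS, hv, h2 v u hS]
  · have : S v = none := by
      by_contra h
      exact hv (h1 v h)
    simp [extendSpine, hv, this]

theorem extendSpine_reach {s : {v // c v = v} → Option {v // c v = v}} {b d : {v // c v = v}} :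
    Relation.ReflTransGen (fun i j => extendSpine c s i = some j) (b : Fin n) d ↔
      Relation.ReflTransGen (SuccRel s) b d := by
  constructor
  · suffices ∀ u, Relation.ReflTransGen (fun i j => extendSpine c s i = some j) (b : Fin n) u →
        ∃ hu : c u = u, Relation.ReflTransGen (SuccRel s) b ⟨u, hu⟩ from
      fun h => (this d h).2
    intro u h
    induction h with
    | refl => exact ⟨b.2, .refl⟩
    | tail _ hbc ih =>
      obtain ⟨_, hu⟩ := ih
      obtain ⟨_, hc, h⟩ := extendSpine_eq_some.1 hbc
      exact ⟨hc, hu.tail h⟩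
  · intro h
    exact h.lift Subtype.val fun i j hij => extendSpine_coe_eq_some.2 hij

theorem extendSpine_acyclic_iff {s : {v // c v = v} → Option {v // c v = v}} :
    (∀ v, ¬ Relation.TransGen (fun i j => extendSpine c s i = some j) v v) ↔
      ∀ b, ¬ Relation.TransGen (SuccRel s) b b := by
  constructor
  · intro h b hb
    exact h b (hb.lift Subtype.val fun i j hij => extendSpine_coe_eq_some.2 hij)
  · intro h v hv
    obtain ⟨u, hu, huv⟩ := Relation.TransGen.tail'_iff.1 hv
    obtain ⟨hcu, hcv, hs⟩ := extendSpine_eq_some.1 huv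
    exact h ⟨v, hcv⟩ (Relation.TransGen.tail' (extendSpine_reach (b := ⟨v, hcv⟩)
      (d := ⟨u, hcu⟩).1 hu) hs)

theorem isMultiCaterpillar_extendSpine {w : Fin n → Fin n} {S : Fin n → Option (Fin n)}
    (hG : IsMultiCaterpillar n (c, w, S)) (s : {v // c v = v} → Option {v // c v = v}) :
    IsMultiCaterpillar n (c, w, extendSpine c s) ↔ IsSpine s := by
  obtain ⟨h1, h2, h3, h4, -⟩ := hG
  constructor
  · rintro ⟨-, -, -, -, -, -, h7, h8⟩
    refine ⟨fun u v d hu hv => ?_, extendSpine_acyclic_iff.1 h8⟩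
    exact Subtype.ext (h7 u v d (extendSpine_coe_eq_some.2 hu) (extendSpine_coe_eq_some.2 hv))
  · rintro ⟨h7, h8⟩
    refine ⟨h1, h2, h3, h4, fun v hv => ?_, fun v u hv => ?_, fun u v d hu hv => ?_,
      extendSpine_acyclic_iff.2 h8⟩
    · by_contra h
      exact hv (by simp only [extendSpine]; exact dif_neg h)
    · exact (extendSpine_eq_some.1 hv).2.1
    · obtain ⟨_, _, hu⟩ := extendSpine_eq_some.1 hu
      obtain ⟨_, _, hv⟩ := extendSpine_eq_some.1 hv
      exact congrArg Subtype.val (h7 _ _ _ hu hv)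

/-- The size of the star of a centre of `c`. -/
noncomputable def starSize (c : Fin n → Fin n) (b : {v // c v = v}) : ℕ := #{u | c u = b}

theorem starSize_pos (b : {v // c v = v}) : 0 < starSize c b :=
  Finset.card_pos.2 ⟨b, by simpa using b.2⟩

theorem card_mcComponent_extendSpine (hc : ∀ v, c (c v) = c v) (w : Fin n → Fin n)
    (s : {v // c v = v} → Option {v // c v = v}) (h : {v // c v = v}) :
    #(mcComponent ((c, w, extendSpine c s) : MCData n) h) =
      ∑ b with Relation.ReflTransGen (SuccRel s) h b, starSize c b := by
  have hreach (v : Fin n) :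
      Relation.ReflTransGen (fun i j => extendSpine c s i = some j) (h : Fin n) (c v) ↔
        Relation.ReflTransGen (SuccRel s) h ⟨c v, hc v⟩ :=
    extendSpine_reach (d := ⟨c v, hc v⟩)
  rw [Finset.card_eq_sum_card_fiberwise (f := fun v => (⟨c v, hc v⟩ : {v // c v = v}))
    (t := univ.filter fun b => Relation.ReflTransGen (SuccRel s) h b)]
  · refine Finset.sum_congr rfl fun b hb => ?_
    have hb' := (mem_filter.1 hb).2
    unfold starSize mcComponent
    rw [Finset.filter_filter]
    congr 1
    refine Finset.filter_congr fun v _ => ?_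
    constructor
    · rintro ⟨-, hv⟩
      exact congrArg Subtype.val hv
    · intro hv
      have : (⟨c v, hc v⟩ : {v // c v = v}) = b := Subtype.ext hv
      exact ⟨(hreach v).2 (this ▸ hb'), this⟩
  · intro v hv
    have hv' := (mem_filter.1 hv).2
    simpa using (hreach v).1 hv'

theorem alphaMC_mul_fMC_extendSpine (hc : ∀ v, c (c v) = c v) (w : Fin n → Fin n) (μ : ℝ → ℝ)
    (x : Fin n → ℝ) (s : {v // c v = v} → Option {v // c v = v}) :
    alphaMC μ ((c, w, extendSpine c s) : MCData n) x *
        fMC ((c, w, extendSpine c s) : MCData n) x =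
      ((-1) ^ #{v | c v = v} * (∏ v, μ (x v)) *
        ∏ v with c v ≠ v, 1 / (x v - x (c v) + ((w v : ℕ) : ℝ))) *
      spineWeight (fun b => (starSize c b : ℝ)) (fun b => x b) s := by
  have hheads : ∏ h ∈ mcHeads ((c, w, extendSpine c s) : MCData n),
      (-1 / (#(mcComponent ((c, w, extendSpine c s) : MCData n) h) : ℝ)) =
      ∏ h ∈ spineHeads s,
        -1 / ∑ b with Relation.ReflTransGen (SuccRel s) h b, (starSize c b : ℝ) := by
    symm
    refine Finset.prod_bij (fun h _ => (h : Fin n)) ?_ (fun _ _ _ _ h => Subtype.ext h) ?_ ?_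
    · intro h hh
      refine mem_filter.2 ⟨mem_univ _, h.2, fun u hu => ?_⟩
      obtain ⟨hu', _, hs⟩ := extendSpine_eq_some.1 hu
      exact mem_spineHeads.1 hh _ hs
    · intro v hv
      obtain ⟨hv1, hv2⟩ := (mem_filter.1 hv).2
      refine ⟨⟨v, hv1⟩, mem_spineHeads.2 fun u hu => ?_, rfl⟩
      exact hv2 u (extendSpine_coe_eq_some.2 hu)
    · intro h _
      rw [card_mcComponent_extendSpine hc]
      push_cast
      rfl
  have hedges : ∏ v with (extendSpine c s v).isSome,
      1 / (x ((extendSpine c s v).getD v) - x v +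
        (#(star' ((c, w, extendSpine c s) : MCData n) v) : ℝ)) =
      ∏ b with (s b).isSome, 1 / (x ((s b).getD b) - x b + (starSize c b : ℝ)) := by
    symm
    refine Finset.prod_bij (fun b _ => (b : Fin n)) ?_ (fun _ _ _ _ h => Subtype.ext h) ?_ ?_
    · intro b hb
      simpa [extendSpine_coe] using hb
    · intro v hv
      obtain ⟨u, hu⟩ := Option.isSome_iff_exists.1 (mem_filter.1 hv).2
      obtain ⟨hv', _, hs⟩ := extendSpine_eq_some.1 hu
      exact ⟨⟨v, hv'⟩, by simp [hs], rfl⟩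
    · intro b hb
      have hstar : #(star' ((c, w, extendSpine c s) : MCData n) b) = starSize c b := by
        unfold star' starSize
        simp only [b.2]
      obtain ⟨u, hu⟩ := Option.isSome_iff_exists.1 (mem_filter.1 hb).2
      rw [hstar, extendSpine_coe, hu]
      rfl
  unfold alphaMC fMC spineWeight
  rw [hheads]
  simp only
  rw [hedges]
  unfold blacks
  ring

/-- For fixed stars and a fixed decoration with a repeated value on the centres, the sum over all
multi-spine graphs vanishes. -/
theorem sum_multiCaterpillar_fixed_stars_eq_zero {w : Fin n → Fin n} {S : Fin n → Option (Fin n)}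
    (hG : IsMultiCaterpillar n (c, w, S)) (μ : ℝ → ℝ) {x : Fin n → ℝ}
    (hx : ∀ i j, x i ≠ x j → ∀ m : ℤ, x i - x j ≠ m)
    {u v : Fin n} (hu : c u = u) (hv : c v = v) (huv : u ≠ v) (hxuv : x u = x v) :
    ∑ G : MCData n with IsMultiCaterpillar n G ∧ (G.1, G.2.1) = (c, w),
      alphaMC μ G x * fMC G x = 0 := by
  have hzero := sum_spineWeight_eq_zero (B := {v // c v = v}) (a := fun b => (starSize c b : ℝ))
    (x := fun b => x b) (fun b => by exact_mod_cast starSize_pos b)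
    (fun i j h => by
      have hpos := starSize_pos i
      by_cases hij : x j = x i
      · rw [hij, sub_self, zero_add] at h
        exact hpos.ne' (by exact_mod_cast h)
      · refine hx j i hij (-(starSize c i : ℤ)) ?_
        push_cast
        linarith)
    (u := ⟨u, hu⟩) (v := ⟨v, hv⟩) (fun h => huv (congrArg Subtype.val h)) hxuv
  rw [← mul_zero ((-1) ^ #{v | c v = v} * (∏ v, μ (x v)) *
        ∏ v with c v ≠ v, 1 / (x v - x (c v) + ((w v : ℕ) : ℝ))), ← hzero, Finset.mul_sum]
  symm
  refine Finset.sum_bij (fun s _ => ((c, w, extendSpine c s) : MCData n)) ?_ ?_ ?_ ?_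
  · intro s hs
    refine mem_filter.2 ⟨mem_univ _, ?_, rfl⟩
    exact (isMultiCaterpillar_extendSpine hG s).2 (mem_filter.1 hs).2
  · intro s _ t _ h
    exact extendSpine_injective (congrArg (fun G : MCData n => G.2.2) h)
  · rintro ⟨c', w', S'⟩ hmem
    obtain ⟨hG', heq⟩ := (mem_filter.1 hmem).2
    obtain ⟨rfl, rfl⟩ : c' = c ∧ w' = w := Prod.mk.inj heq
    obtain ⟨s, rfl⟩ := exists_extendSpine (c := c') hG'.2.2.2.2.1 hG'.2.2.2.2.2.1
    exact ⟨s, by simpa using (isMultiCaterpillar_extendSpine hG s).1 hG', rfl⟩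
  · intro s _
    exact (alphaMC_mul_fMC_extendSpine hG.1 w μ x s).symm

end transfer

/-- In the double sum over multi-caterpillar graphs and their decorations, the sum
does not change when it is restricted to black-injective decorations. -/
theorem multiCaterpillar_blackInjective_sum (n : ℕ) (hn : 1 ≤ n)
    (𝕏 : Finset ℝ)
    (h𝕏 : ∀ s ∈ 𝕏, ∀ t ∈ 𝕏, s ≠ t → ∀ m : ℤ, s - t ≠ (m : ℝ))
    (μ : ℝ → ℝ) (u₀ : ℝ) :
    ∑ G ∈ univ.filter (IsMultiCaterpillar n),
      ∑ d ∈ (univ : Finset (Fin n → {y // y ∈ 𝕏})).filter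
          (fun d => ∀ v, G.1 v = v → (d v : ℝ) ≤ u₀),
        alphaMC μ G (fun v => (d v : ℝ)) * fMC G (fun v => (d v : ℝ)) =
    ∑ G ∈ univ.filter (IsMultiCaterpillar n),
      ∑ d ∈ (univ : Finset (Fin n → {y // y ∈ 𝕏})).filter
          (fun d => (∀ v, G.1 v = v → (d v : ℝ) ≤ u₀) ∧
            (∀ u v, G.1 u = u → G.1 v = v → d u = d v → u = v)),
        alphaMC μ G (fun v => (d v : ℝ)) * fMC G (fun v => (d v : ℝ)) := by
  have hsplit : ∀ G : MCData n,
      ∑ d ∈ (univ : Finset (Fin n → {y // y ∈ 𝕏})).filter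
          (fun d => ∀ v, G.1 v = v → (d v : ℝ) ≤ u₀),
        alphaMC μ G (fun v => (d v : ℝ)) * fMC G (fun v => (d v : ℝ)) =
      ∑ d ∈ (univ : Finset (Fin n → {y // y ∈ 𝕏})).filter
          (fun d => (∀ v, G.1 v = v → (d v : ℝ) ≤ u₀) ∧
            (∀ u v, G.1 u = u → G.1 v = v → d u = d v → u = v)),
        alphaMC μ G (fun v => (d v : ℝ)) * fMC G (fun v => (d v : ℝ)) +
      ∑ d ∈ (univ : Finset (Fin n → {y // y ∈ 𝕏})).filter
          (fun d => (∀ v, G.1 v = v → (d v : ℝ) ≤ u₀) ∧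
            ¬ (∀ u v, G.1 u = u → G.1 v = v → d u = d v → u = v)),
        alphaMC μ G (fun v => (d v : ℝ)) * fMC G (fun v => (d v : ℝ)) := by
    intro G
    rw [← Finset.filter_filter, ← Finset.filter_filter, Finset.sum_filter_add_sum_filter_not]
  rw [Finset.sum_congr rfl fun G _ => hsplit G, Finset.sum_add_distrib, add_eq_left]
  simp only [Finset.sum_filter (fun d : Fin n → {y // y ∈ 𝕏} => _ ∧ ¬ _)]
  rw [Finset.sum_comm]
  refine Finset.sum_eq_zero fun d _ => ?_
  rw [← Finset.sum_fiberwise _ (fun G : MCData n => (G.1, G.2.1))]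
  refine Finset.sum_eq_zero fun cw _ => ?_
  obtain ⟨c, w⟩ := cw
  by_cases hP : (∀ v, c v = v → (d v : ℝ) ≤ u₀) ∧
      ¬ (∀ u v, c u = u → c v = v → d u = d v → u = v)
  · by_cases hex : ∃ S, IsMultiCaterpillar n (c, w, S)
    · obtain ⟨S, hS⟩ := hex
      obtain ⟨u, v, hu, hv, hd, huv⟩ : ∃ u v, c u = u ∧ c v = v ∧ d u = d v ∧ u ≠ v := by
        have := hP.2
        push Not at this
        exact this
      rw [← sum_multiCaterpillar_fixed_stars_eq_zero hS μ (x := fun v => (d v : ℝ))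
        (fun i j hij => h𝕏 _ (d i).2 _ (d j).2 hij) hu hv huv (congrArg Subtype.val hd),
        Finset.filter_filter]
      refine Finset.sum_congr rfl fun G hG => if_pos ?_
      have hc : G.1 = c := congrArg Prod.fst (mem_filter.1 hG).2.2
      rw [hc]
      exact hP
    · refine Finset.sum_eq_zero fun G hG => absurd ?_ hex
      obtain ⟨hmem, heq⟩ := mem_filter.1 hG
      obtain ⟨c', w', S⟩ := G
      obtain ⟨rfl, rfl⟩ : c' = c ∧ w' = w := Prod.mk.inj heq
      exact ⟨S, (mem_filter.1 hmem).2⟩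
  · refine Finset.sum_eq_zero fun G hG => if_neg ?_
    have hc : G.1 = c := congrArg Prod.fst (mem_filter.1 hG).2
    rw [hc]
    exact hP
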